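/- A finite simple graph G is critical-primitive if and only if there exists r ≥ 2 such that G is isomorphic to the graph 𝒢_r or to the complement of 𝒢_r. -/

import Mathlib

/-- `M` is a module of `G`. -/
def IsModule {V : Type} (G : SimpleGraph V) (M : Set V) : Prop :=
  ∀ z ∉ M, (∀ x ∈ M, G.Adj z x) ∨ (∀ x ∈ M, ¬ G.Adj z x)

/-- A graph is primitive if it has at least four vertices and all of its
modules are trivial. -/
def IsPrimitive {V : Type} (G : SimpleGraph V) : Prop :=
  4 ≤ Nat.card V ∧
    ∀ M : Set V, IsModule G M → M = ∅ ∨ (∃ x, M = {x}) ∨ M = Set.univ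

/-- A graph is critical-primitive if it is primitive and deleting any vertex
destroys primitivity. -/
def IsCriticalPrimitive {V : Type} (G : SimpleGraph V) : Prop :=
  IsPrimitive G ∧ ∀ x : V, ¬ IsPrimitive (G.induce ({x}ᶜ : Set V))

/-- The graph `𝒢_r` on vertices `a₁, …, a_r, b₁, …, b_r` whose edges are
exactly the pairs `{a_i, b_j}` with `i ≥ j`. -/
def calG (r : ℕ) : SimpleGraph (Fin r ⊕ Fin r) :=
  SimpleGraph.fromRel (fun x y =>
    ∃ i j : Fin r, j ≤ i ∧ x = Sum.inl i ∧ y = Sum.inr j)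

section HalfGraphs

variable {V : Type}

/-- `M` is a module of the subgraph of `G` induced on `X`. -/
def IsModuleOn (G : SimpleGraph V) (X M : Set V) : Prop :=
  ∀ z ∈ X, z ∉ M → ∀ a ∈ M, ∀ b ∈ M, (G.Adj z a ↔ G.Adj z b)

/-- All modules of the subgraph of `G` induced on `X` are trivial. -/
def IsPrimeOn (G : SimpleGraph V) (X : Set V) : Prop :=
  ∀ M ⊆ X, IsModuleOn G X M → M.Subsingleton ∨ M = X

/-- `x` does not distinguish the vertices of `X`. -/
def IsConstOn (G : SimpleGraph V) (X : Set V) (x : V) : Prop :=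
  ∀ a ∈ X, ∀ b ∈ X, (G.Adj x a ↔ G.Adj x b)

/-- No vertex of `X` other than `u` distinguishes `u` from `x`. -/
def IsTwinOn (G : SimpleGraph V) (X : Set V) (u x : V) : Prop :=
  u ∈ X ∧ ∀ a ∈ X, a ≠ u → (G.Adj x a ↔ G.Adj u a)

theorem isModuleOn_compl {G : SimpleGraph V} {X M : Set V} :
    IsModuleOn Gᶜ X M ↔ IsModuleOn G X M := by
  have key : ∀ z ∈ X, z ∉ M → ∀ a ∈ M, ∀ b ∈ M,
      ((Gᶜ.Adj z a ↔ Gᶜ.Adj z b) ↔ (G.Adj z a ↔ G.Adj z b)) := by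
    intro z _ hzM a ha b hb
    have h1 : z ≠ a := fun h => hzM (h ▸ ha)
    have h2 : z ≠ b := fun h => hzM (h ▸ hb)
    simp only [SimpleGraph.compl_adj, h1, h2, ne_eq, not_false_eq_true, true_and]
    tauto
  constructor
  · intro h z hz hzM a ha b hb
    exact (key z hz hzM a ha b hb).1 (h z hz hzM a ha b hb)
  · intro h z hz hzM a ha b hb
    exact (key z hz hzM a ha b hb).2 (h z hz hzM a ha b hb)

theorem isPrimeOn_compl {G : SimpleGraph V} {X : Set V} :
    IsPrimeOn Gᶜ X ↔ IsPrimeOn G X :=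
  ⟨fun h M hM hm => h M hM (isModuleOn_compl.2 hm),
    fun h M hM hm => h M hM (isModuleOn_compl.1 hm)⟩

theorem IsPrimeOn.inter_eq {G : SimpleGraph V} {X Y M : Set V} (hX : IsPrimeOn G X)
    (hXY : X ⊆ Y) (hM : IsModuleOn G Y M) :
    M ∩ X = ∅ ∨ (∃ w ∈ X, M ∩ X = {w}) ∨ X ⊆ M := by
  rcases hX (M ∩ X) Set.inter_subset_right (fun z hz hzM a ha b hb =>
    hM z (hXY hz) (fun h => hzM ⟨h, hz⟩) a ha.1 b hb.1) with h | h
  · rcases h.eq_empty_or_singleton with h | ⟨w, h⟩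
    · exact Or.inl h
    · exact Or.inr (Or.inl ⟨w, (h.symm.subset rfl).2, h⟩)
  · exact Or.inr (Or.inr (Set.inter_eq_right.1 h))

theorem IsPrimeOn.insert_cases {G : SimpleGraph V} {X : Set V} {x : V} (hX : IsPrimeOn G X)
    (hx : x ∉ X) (h : ¬ IsPrimeOn G (insert x X)) :
    IsConstOn G X x ∨ ∃ u, IsTwinOn G X u x := by
  simp only [IsPrimeOn, not_forall, not_or] at h
  obtain ⟨M, hMs, hM, hns, hne⟩ := h
  have hnt : ∃ a ∈ M, ∃ b ∈ M, a ≠ b := Set.not_subsingleton_iff.1 hns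
  have hnf : ∃ a ∈ insert x X, a ∉ M := by
    by_contra hc
    push Not at hc
    exact hne (Set.Subset.antisymm hMs hc)
  rcases hX.inter_eq (Set.subset_insert x X) hM with h | ⟨w, hw, h⟩ | h
  · obtain ⟨a, ha, b, hb, hab⟩ := hnt
    have key : ∀ c ∈ M, c = x := fun c hc => by
      rcases hMs hc with h' | h'
      · exact h'
      · exact absurd (show c ∈ M ∩ X from ⟨hc, h'⟩) (by simp [h])
    exact absurd ((key a ha).trans (key b hb).symm) hab
  · right
    have key : ∀ c ∈ X, c ∈ M ↔ c = w := fun c hc => by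
      have : c ∈ M ∩ X ↔ c = w := by rw [h]; rfl
      simpa [hc] using this
    refine ⟨w, hw, fun a ha haw => ?_⟩
    have hxM : x ∈ M := by
      by_contra hxM
      obtain ⟨a, ha, b, hb, hab⟩ := hnt
      have e : ∀ c ∈ M, c = w := fun c hc => by
        rcases hMs hc with h' | h'
        · exact absurd (h' ▸ hc) hxM
        · exact (key c h').1 hc
      exact hab ((e a ha).trans (e b hb).symm)
    have := hM a (Or.inr ha) (fun h' => haw ((key a ha).1 h')) x hxM w ((key w hw).2 rfl)
    rwa [G.adj_comm x, G.adj_comm w]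
  · left
    have hxM : x ∉ M := by
      obtain ⟨a, ha, haM⟩ := hnf
      rcases ha with rfl | ha
      · exact haM
      · exact absurd (h ha) haM
    exact fun a ha b hb => hM x (Or.inl rfl) hxM a (h ha) b (h hb)

theorem IsPrimeOn.insert_insert_cases {G : SimpleGraph V} {X : Set V} {x y : V}
    (hX : IsPrimeOn G X) (hx : x ∉ X) (hy : y ∉ X) (hxy : x ≠ y)
    (h : ¬ IsPrimeOn G (insert x (insert y X))) :
    (∀ a ∈ X, (G.Adj x a ↔ G.Adj y a)) ∨
    (∃ w, IsTwinOn G X w x ∧ (G.Adj y x ↔ G.Adj y w)) ∨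
    (∃ w, IsTwinOn G X w y ∧ (G.Adj x y ↔ G.Adj x w)) ∨
    (∃ w, IsTwinOn G X w x ∧ IsTwinOn G X w y) ∨
    (IsConstOn G X x ∧ IsConstOn G X y) ∨
    (IsConstOn G X y ∧ ∀ a ∈ X, (G.Adj y x ↔ G.Adj y a)) ∨
    (IsConstOn G X x ∧ ∀ a ∈ X, (G.Adj x y ↔ G.Adj x a)) := by
  simp only [IsPrimeOn, not_forall, not_or] at h
  obtain ⟨M, hMs, hM, hns, hne⟩ := h
  have hnt : ∃ a ∈ M, ∃ b ∈ M, a ≠ b := Set.not_subsingleton_iff.1 hns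
  have hnf : ∃ a ∈ insert x (insert y X), a ∉ M := by
    by_contra hc
    push Not at hc
    exact hne (Set.Subset.antisymm hMs hc)
  have hMs' : ∀ c ∈ M, c = x ∨ c = y ∨ c ∈ X := fun c hc => hMs hc
  have hM' : ∀ z, (z = x ∨ z = y ∨ z ∈ X) → z ∉ M → ∀ a ∈ M, ∀ b ∈ M,
    (G.Adj z a ↔ G.Adj z b) := hM
  have hXY : X ⊆ insert x (insert y X) :=
    (Set.subset_insert y X).trans (Set.subset_insert x _)
  rcases hX.inter_eq hXY hM with h | ⟨w, hw, h⟩ | h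
  · left
    have key : ∀ c ∈ X, c ∉ M := fun c hc hcM =>
      absurd (show c ∈ M ∩ X from ⟨hcM, hc⟩) (by simp [h])
    have hxM : x ∈ M ∧ y ∈ M := by grind
    intro a ha
    have := hM' a (Or.inr (Or.inr ha)) (key a ha) x hxM.1 y hxM.2
    rwa [G.adj_comm x, G.adj_comm y]
  · have key : ∀ c ∈ X, c ∈ M ↔ c = w := fun c hc => by
      have : c ∈ M ∩ X ↔ c = w := by rw [h]; rfl
      simpa [hc] using this
    have hwM : w ∈ M := (key w hw).2 rfl
    have twin : ∀ z ∈ M, IsTwinOn G X w z := fun z hz => ⟨hw, fun a ha haw => by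
      have := hM' a (Or.inr (Or.inr ha)) (fun h' => haw ((key a ha).1 h')) z hz w hwM
      rwa [G.adj_comm z, G.adj_comm w]⟩
    by_cases hxM : x ∈ M <;> by_cases hyM : y ∈ M
    · exact Or.inr (Or.inr (Or.inr (Or.inl ⟨w, twin x hxM, twin y hyM⟩)))
    · exact Or.inr (Or.inl ⟨w, twin x hxM, hM' y (by simp) hyM x hxM w hwM⟩)
    · exact Or.inr (Or.inr (Or.inl ⟨w, twin y hyM, hM' x (by simp) hxM y hyM w hwM⟩))
    · grind
  · have const : ∀ z, (z = x ∨ z = y ∨ z ∈ X) → z ∉ M → IsConstOn G X z :=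
      fun z hz hzM a ha b hb => hM' z hz hzM a (h ha) b (h hb)
    by_cases hxM : x ∈ M <;> by_cases hyM : y ∈ M
    · obtain ⟨a, ha, haM⟩ := hnf
      rcases ha with rfl | rfl | ha
      · exact absurd hxM haM
      · exact absurd hyM haM
      · exact absurd (h ha) haM
    · exact Or.inr (Or.inr (Or.inr (Or.inr (Or.inr (Or.inl
        ⟨const y (by simp) hyM, fun a ha => hM' y (by simp) hyM x hxM a (h ha)⟩)))))
    · exact Or.inr (Or.inr (Or.inr (Or.inr (Or.inr (Or.inr
        ⟨const x (by simp) hxM, fun a ha => hM' x (by simp) hxM y hyM a (h ha)⟩)))))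
    · exact Or.inr (Or.inr (Or.inr (Or.inr (Or.inl
        ⟨const x (by simp) hxM, const y (by simp) hyM⟩))))

theorem exists_mem_ne_ne {X : Set V} (h3 : 3 ≤ X.ncard) (u w : V) :
    ∃ t ∈ X, t ≠ u ∧ t ≠ w := by
  by_contra! hc
  have hs : X ⊆ {u, w} := fun t ht => by
    by_cases h : t = u
    · exact Or.inl h
    · exact Or.inr (hc t ht h)
  have := Set.ncard_le_ncard hs (Set.toFinite _)
  have := Set.ncard_insert_le u {w}
  rw [Set.ncard_singleton] at this
  omega

theorem IsPrimeOn.not_const_of_twin {G : SimpleGraph V} {X : Set V} {u x : V}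
    (hX : IsPrimeOn G X) (h3 : 3 ≤ X.ncard) (hu : IsTwinOn G X u x) :
    ¬ IsConstOn G X x := by
  intro hc
  rcases hX (X \ {u}) Set.sdiff_subset (fun z hz hzM a ha b hb => by
    have hzu : z = u := by
      by_contra hzu
      exact hzM ⟨hz, hzu⟩
    subst hzu
    rw [← hu.2 a ha.1 ha.2, ← hu.2 b hb.1 hb.2]
    exact hc a ha.1 b hb.1) with h | h
  · obtain ⟨s, hs, hsu, -⟩ := exists_mem_ne_ne h3 u u
    obtain ⟨t, ht, htu, hts⟩ := exists_mem_ne_ne h3 u s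
    exact hts (h ⟨ht, htu⟩ ⟨hs, hsu⟩)
  · exact (h.symm.subset hu.1).2 rfl

theorem IsPrimeOn.twin_unique {G : SimpleGraph V} {X : Set V} {u w x : V}
    (hX : IsPrimeOn G X) (h3 : 3 ≤ X.ncard) (hu : IsTwinOn G X u x)
    (hw : IsTwinOn G X w x) : u = w := by
  rcases hX {u, w} (by rintro _ (rfl | rfl); exacts [hu.1, hw.1]) (fun z hz hzM a ha b hb => by
    have hzu : z ≠ u := fun h => hzM (Or.inl h)
    have hzw : z ≠ w := fun h => hzM (Or.inr h)
    have e1 := hu.2 z hz hzu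
    have e2 := hw.2 z hz hzw
    have e : G.Adj z u ↔ G.Adj z w := by
      rw [G.adj_comm z, G.adj_comm z, ← e1, ← e2]
    rcases ha with rfl | rfl <;> rcases hb with rfl | rfl <;> first | rfl | exact e | exact e.symm)
    with h | h
  · exact h (Or.inl rfl) (Or.inr rfl)
  · obtain ⟨t, ht, htu, htw⟩ := exists_mem_ne_ne h3 u w
    rw [← h] at ht
    rcases ht with h | h
    · exact absurd h htu
    · exact absurd h htw

/-- A prime induced subgraph missing at least two vertices of a prime graph can be enlarged by
two vertices to a prime induced subgraph (Ehrenfeucht and Rozenberg). -/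
theorem IsPrimeOn.exists_insert_insert {G : SimpleGraph V} {X : Set V}
    (hG : IsPrimeOn G Set.univ) (hX : IsPrimeOn G X) (h3 : 3 ≤ X.ncard)
    {x₀ y₀ : V} (hx₀ : x₀ ∉ X) (hy₀ : y₀ ∉ X) (hxy₀ : x₀ ≠ y₀) :
    ∃ x y, x ∉ X ∧ y ∉ X ∧ x ≠ y ∧ IsPrimeOn G (insert x (insert y X)) := by
  by_contra! hcon
  have C := fun x y hx hy hxy => hX.insert_insert_cases hx hy hxy (hcon x y hx hy hxy)
  have T1 := fun u x (hu : IsTwinOn G X u x) => hX.not_const_of_twin h3 hu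
  have T2 := fun u w x (hu : IsTwinOn G X u x) (hw : IsTwinOn G X w x) => hX.twin_unique h3 hu hw
  by_cases hT : ∃ u x, x ∉ X ∧ IsTwinOn G X u x
  · obtain ⟨u, x, hx, hu⟩ := hT
    rcases hG {z | z = u ∨ (z ∉ X ∧ IsTwinOn G X u z)} (Set.subset_univ _) (by
      intro z _ hz
      simp only [Set.mem_ofPred_eq, not_or, not_and] at hz
      obtain ⟨hzu, hz⟩ := hz
      have key : ∀ a, (a = u ∨ (a ∉ X ∧ IsTwinOn G X u a)) → (G.Adj z a ↔ G.Adj z u) := by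
        rintro a (rfl | ⟨haX, ha⟩)
        · rfl
        by_cases hzX : z ∈ X
        · have := ha.2 z hzX hzu
          rwa [G.adj_comm z, G.adj_comm z]
        have hz := hz hzX
        have haz : a ≠ z := fun h => hz (h ▸ ha)
        have hua := ha.2
        have huX := ha.1
        rcases C a z haX hzX haz with h | ⟨w, h, h'⟩ | ⟨w, h, h'⟩ | ⟨w, h, h'⟩ | ⟨h, h'⟩ |
          ⟨h, h'⟩ | ⟨h, h'⟩
        · exact absurd ⟨huX, fun b hb hbu => (h b hb).symm.trans (ha.2 b hb hbu)⟩ hz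
        · rw [T2 _ _ _ ha h]; exact h'
        · have hwu : w ≠ u := fun e => hz (e ▸ h)
          have e1 := hua w h.1 hwu
          have e2 := h.2 u huX hwu.symm
          rw [G.adj_comm z a, h', e1, e2, G.adj_comm]
        · exact absurd (T2 _ _ _ ha h ▸ h') hz
        · exact absurd h (T1 _ _ ha)
        · exact h' u huX
        · exact absurd h (T1 _ _ ha)
      intro a ha b hb
      exact (key a ha).trans (key b hb).symm) with h | h
    · exact hx ((h (Or.inl rfl) (Or.inr ⟨hx, hu⟩) : u = x) ▸ hu.1)
    · obtain ⟨t, ht, htu, -⟩ := exists_mem_ne_ne h3 u u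
      rcases h.symm.subset (Set.mem_univ t) with h | h
      · exact htu h
      · exact h.1 ht
  push Not at hT
  obtain ⟨s, hs, -, -⟩ := exists_mem_ne_ne h3 x₀ x₀
  obtain ⟨t, ht, hts, -⟩ := exists_mem_ne_ne h3 s s
  by_cases hS : ∃ x, x ∉ X ∧ IsConstOn G X x
  · obtain ⟨x, hx, hc⟩ := hS
    rcases hG {z | z ∈ X ∨ ¬ IsConstOn G X z} (Set.subset_univ _) (by
      intro z _ hz
      simp only [Set.mem_ofPred_eq, not_or, not_not] at hz
      obtain ⟨hzX, hz⟩ := hz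
      have key : ∀ a, (a ∈ X ∨ ¬ IsConstOn G X a) → (G.Adj z a ↔ G.Adj z s) := by
        intro a ha
        by_cases haX : a ∈ X
        · exact hz a haX s hs
        have ha : ¬ IsConstOn G X a := ha.resolve_left haX
        have haz : a ≠ z := fun h => ha (h ▸ hz)
        rcases C a z haX hzX haz with h | ⟨w, h, h'⟩ | ⟨w, h, h'⟩ | ⟨w, h, h'⟩ | ⟨h, h'⟩ |
          ⟨h, h'⟩ | ⟨h, h'⟩
        · exact absurd (fun b hb c hc => (h b hb).trans ((hz b hb c hc).trans (h c hc).symm)) ha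
        · exact absurd h (hT _ _ haX)
        · exact absurd h (hT _ _ hzX)
        · exact absurd h (hT _ _ haX)
        · exact absurd h ha
        · exact h' s hs
        · exact absurd h ha
      intro a ha b hb
      exact (key a ha).trans (key b hb).symm) with h | h
    · exact hts (h (Or.inl ht) (Or.inl hs))
    · rcases h.symm.subset (Set.mem_univ x) with h | h
      · exact hx h
      · exact h hc
  push Not at hS
  rcases hG Xᶜ (Set.subset_univ _) (by
    intro z _ hz a ha b hb
    have hz : z ∈ X := by simpa using hz
    by_cases hab : a = b
    · rw [hab]
    rcases C a b ha hb hab with h | ⟨w, h, h'⟩ | ⟨w, h, h'⟩ | ⟨w, h, h'⟩ | ⟨h, h'⟩ |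
          ⟨h, h'⟩ | ⟨h, h'⟩
    · rw [G.adj_comm z, G.adj_comm z]; exact h z hz
    · exact absurd h (hT _ _ ha)
    · exact absurd h (hT _ _ hb)
    · exact absurd h (hT _ _ ha)
    · exact absurd h (hS _ ha)
    · exact absurd h (hS _ hb)
    · exact absurd h (hS _ ha)) with h | h
  · exact hxy₀ (h hx₀ hy₀)
  · exact (h.symm.subset (Set.mem_univ s)) hs

/-- The adjacency relation of half graphs whose vertices are listed as `b₁, a₁, b₂, a₂, …`. -/
def HalfAdj (i j : ℕ) : Prop :=
  (i < j ∧ i % 2 = 0 ∧ j % 2 = 1) ∨ (j < i ∧ j % 2 = 0 ∧ i % 2 = 1)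

theorem halfAdj_comm (i j : ℕ) : HalfAdj i j ↔ HalfAdj j i := or_comm

/-- `v 0, …, v (n - 1)` are distinct vertices of `G` inducing a half graph. -/
structure IsHalfSeq (G : SimpleGraph V) (n : ℕ) (v : ℕ → V) : Prop where
  inj : ∀ i < n, ∀ j < n, v i = v j → i = j
  adj : ∀ i < n, ∀ j < n, (G.Adj (v i) (v j) ↔ HalfAdj i j)

theorem IsHalfSeq.reverse {G : SimpleGraph V} {n : ℕ} {v : ℕ → V} (h : IsHalfSeq G n v)
    (hn : n % 2 = 0) : IsHalfSeq G n (fun i => v (n - 1 - i)) where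
  inj i hi j hj e := by
    have := h.inj _ (by omega) _ (by omega) e
    omega
  adj i hi j hj := by
    rw [h.adj _ (by omega) _ (by omega)]
    unfold HalfAdj
    omega

/-- The path on four vertices, listed so as to exhibit its complement as a half graph. -/
def complOrder (i : ℕ) : ℕ := if i = 0 then 2 else if i = 1 then 0 else if i = 2 then 3 else 1

theorem IsHalfSeq.compl {G : SimpleGraph V} {v : ℕ → V} (h : IsHalfSeq G 4 v) :
    IsHalfSeq Gᶜ 4 (fun i => v (complOrder i)) where
  inj i hi j hj e := by
    have := h.inj _ (by unfold complOrder; split_ifs <;> omega) _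
      (by unfold complOrder; split_ifs <;> omega) e
    unfold complOrder at this
    split_ifs at this <;> omega
  adj i hi j hj := by
    have hi' : complOrder i < 4 := by unfold complOrder; split_ifs <;> omega
    have hj' : complOrder j < 4 := by unfold complOrder; split_ifs <;> omega
    have e : v (complOrder i) = v (complOrder j) ↔ complOrder i = complOrder j :=
      ⟨h.inj _ hi' _ hj', fun e => by rw [e]⟩
    rw [SimpleGraph.compl_adj, h.adj _ hi' _ hj', Ne, e]
    unfold HalfAdj complOrder
    interval_cases i <;> interval_cases j <;> simp

theorem IsHalfSeq.isPrimeOn {G : SimpleGraph V} {n : ℕ} {v : ℕ → V} (h : IsHalfSeq G n v)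
    (hn : n % 2 = 0) : IsPrimeOn G (v '' Set.Iio n) := by
  intro M hMX hM
  by_contra! hcon
  obtain ⟨hns, hne⟩ := hcon
  have D : ∀ i < n, ∀ j < n, ∀ k < n, v i ∈ M → v j ∈ M →
      ¬ (HalfAdj k i ↔ HalfAdj k j) → v k ∈ M := by
    intro i hi j hj k hk hiM hjM hd
    by_contra hkM
    have := hM (v k) ⟨k, hk, rfl⟩ hkM _ hiM _ hjM
    rw [h.adj k hk i hi, h.adj k hk j hj] at this
    exact hd this
  have full : ∀ i < n, ∀ j < n, i < j → i % 2 = 0 → j % 2 = 1 → v i ∈ M → v j ∈ M → False := by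
    intro i hi j hj hij hi2 hj2 hiM hjM
    have h0 : v 0 ∈ M := by
      by_cases h0 : i = 0
      · rwa [← h0]
      · exact D i hi j hj 0 (by omega) hiM hjM (by unfold HalfAdj; omega)
    have h1 : v (n - 1) ∈ M := by
      by_cases h1 : j = n - 1
      · rwa [← h1]
      · exact D i hi j hj (n - 1) (by omega) hiM hjM (by unfold HalfAdj; omega)
    refine hne (Set.Subset.antisymm hMX ?_)
    rintro _ ⟨k, hk, rfl⟩
    have hk : k < n := hk
    by_cases hk0 : k = 0
    · rwa [hk0]
    by_cases hk1 : k = n - 1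
    · rwa [hk1]
    exact D 0 (by omega) (n - 1) (by omega) k hk h0 h1 (by unfold HalfAdj; omega)
  have odd_even : ∀ i < n, ∀ j < n, i < j → i % 2 = 1 → j % 2 = 0 →
      v i ∈ M → v j ∈ M → False := by
    intro i hi j hj hij hi2 hj2 hiM hjM
    have h1 : v (n - 1) ∈ M :=
      D i hi j hj (n - 1) (by omega) hiM hjM (by unfold HalfAdj; omega)
    exact full j hj (n - 1) (by omega) (by omega) hj2 (by omega) hjM h1
  have lt : ∀ i < n, ∀ j < n, i < j → v i ∈ M → v j ∈ M → False := by
    intro i hi j hj hij hiM hjM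
    rcases Nat.mod_two_eq_zero_or_one i with hi2 | hi2 <;>
      rcases Nat.mod_two_eq_zero_or_one j with hj2 | hj2
    · exact full i hi (i + 1) (by omega) (by omega) hi2 (by omega) hiM
        (D i hi j hj (i + 1) (by omega) hiM hjM (by unfold HalfAdj; omega))
    · exact full i hi j hj hij hi2 hj2 hiM hjM
    · exact odd_even i hi j hj hij hi2 hj2 hiM hjM
    · exact odd_even i hi (i + 1) (by omega) (by omega) hi2 (by omega) hiM
        (D i hi j hj (i + 1) (by omega) hiM hjM (by unfold HalfAdj; omega))
  obtain ⟨a, ha, b, hb, hab⟩ := hns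
  obtain ⟨i, hi, rfl⟩ := hMX ha
  obtain ⟨j, hj, rfl⟩ := hMX hb
  rcases lt_trichotomy i j with hij | rfl | hij
  · exact lt i hi j hj hij ha hb
  · exact hab rfl
  · exact lt j hj i hi hij hb ha

theorem IsHalfSeq.ncard {G : SimpleGraph V} {n : ℕ} {v : ℕ → V} (h : IsHalfSeq G n v) :
    (v '' Set.Iio n).ncard = n := by
  have hinj : Set.InjOn v (Set.Iio n) := fun i hi j hj e => h.inj i hi j hj e
  rw [hinj.ncard_image, Set.ncard_Iio_nat]

theorem IsHalfSeq.update {G : SimpleGraph V} {n p : ℕ} {v : ℕ → V} {x : V}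
    (h : IsHalfSeq G n v) (hx : ∀ i < n, v i ≠ x)
    (hxp : ∀ i < n, i ≠ p → (G.Adj x (v i) ↔ HalfAdj p i)) :
    IsHalfSeq G n (Function.update v p x) where
  inj i hi j hj e := by
    simp only [Function.update_apply] at e
    split_ifs at e with h1 h2 h2
    · omega
    · exact absurd e.symm (hx j hj)
    · exact absurd e (hx i hi)
    · exact h.inj i hi j hj e
  adj i hi j hj := by
    simp only [Function.update_apply]
    split_ifs with h1 h2 h2
    · subst h1 h2
      simp [HalfAdj]
    · subst h1
      exact hxp j hj h2
    · subst h2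
      rw [G.adj_comm, halfAdj_comm]
      exact hxp i hi h1
    · exact h.adj i hi j hj

/-- Twins `x` of `v p` and `y` of `v (p + 1)` can be inserted between these two vertices. -/
theorem IsHalfSeq.insert_twins {G : SimpleGraph V} {n p : ℕ} {v : ℕ → V} {x y : V}
    (h : IsHalfSeq G n v) (hx : ∀ i < n, v i ≠ x) (hy : ∀ i < n, v i ≠ y) (hxy : x ≠ y)
    (hp : p + 1 < n)
    (hxp : ∀ i < n, (G.Adj x (v i) ↔ HalfAdj p i))
    (hyp : ∀ i < n, (G.Adj y (v i) ↔ HalfAdj (p + 1) i))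
    (hadj : G.Adj x y ↔ ¬ HalfAdj p (p + 1)) :
    ∃ v', IsHalfSeq G (n + 2) v' := by
  refine ⟨fun i => if i ≤ p then v i else if i = p + 1 then y else if i = p + 2 then x
    else v (i - 2), fun i hi j hj e => ?_, fun i hi j hj => ?_⟩
  · split_ifs at e <;>
      first
      | omega
      | (have := h.inj _ (by omega) _ (by omega) e; omega)
      | exact absurd e (hx _ (by omega))
      | exact absurd e (hy _ (by omega))
      | exact absurd e.symm (hx _ (by omega))
      | exact absurd e.symm (hy _ (by omega))
      | exact absurd e hxy
      | exact absurd e.symm hxy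
  · have e1 : ∀ i < n, (G.Adj (v i) x ↔ HalfAdj p i) := fun i hi => by rw [G.adj_comm, hxp i hi]
    have e2 : ∀ i < n, (G.Adj (v i) y ↔ HalfAdj (p + 1) i) := fun i hi => by
      rw [G.adj_comm, hyp i hi]
    have e3 : G.Adj y x ↔ ¬ HalfAdj p (p + 1) := by rw [G.adj_comm, hadj]
    split_ifs <;>
      first
      | exact h.adj _ (by omega) _ (by omega)
      | rw [h.adj _ (by omega) _ (by omega)]; unfold HalfAdj; omega
      | rw [e1 _ (by omega)]; unfold HalfAdj; omega
      | rw [e2 _ (by omega)]; unfold HalfAdj; omega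
      | rw [hxp _ (by omega)]; unfold HalfAdj; omega
      | rw [hyp _ (by omega)]; unfold HalfAdj; omega
      | rw [e3]; unfold HalfAdj; omega
      | rw [hadj]; unfold HalfAdj; omega
      | (simp only [SimpleGraph.irrefl, false_iff]; unfold HalfAdj; omega)

/-- An isolated vertex `x` and a twin `y` of the last vertex, with `x` and `y` adjacent, can be
appended to a half graph. -/
theorem IsHalfSeq.append {G : SimpleGraph V} {n : ℕ} {v : ℕ → V} {x y : V}
    (h : IsHalfSeq G n v) (hn : n % 2 = 0) (hn2 : 2 ≤ n)
    (hx : ∀ i < n, v i ≠ x) (hy : ∀ i < n, v i ≠ y)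
    (hxp : ∀ i < n, ¬ G.Adj x (v i))
    (hyp : ∀ i < n, (G.Adj y (v i) ↔ HalfAdj (n - 1) i))
    (hadj : G.Adj x y) :
    ∃ v', IsHalfSeq G (n + 2) v' := by
  refine ⟨fun i => if i < n then v i else if i = n then x else y,
    fun i hi j hj e => ?_, fun i hi j hj => ?_⟩
  · have hxy := hadj.ne
    split_ifs at e <;>
      first
      | omega
      | (have := h.inj _ (by omega) _ (by omega) e; omega)
      | exact absurd e (hx _ (by omega))
      | exact absurd e (hy _ (by omega))
      | exact absurd e.symm (hx _ (by omega))
      | exact absurd e.symm (hy _ (by omega))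
      | exact absurd e hxy
      | exact absurd e.symm hxy
  · have e1 : ∀ i < n, ¬ G.Adj (v i) x := fun i hi => by rw [G.adj_comm]; exact hxp i hi
    have e2 : ∀ i < n, (G.Adj (v i) y ↔ HalfAdj (n - 1) i) := fun i hi => by
      rw [G.adj_comm, hyp i hi]
    split_ifs <;>
      first
      | exact h.adj _ (by omega) _ (by omega)
      | (simp only [e1 _ (show _ < n by omega), false_iff]; unfold HalfAdj; omega)
      | rw [e2 _ (by omega)]; unfold HalfAdj; omega
      | (simp only [hxp _ (show _ < n by omega), false_iff]; unfold HalfAdj; omega)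
      | rw [hyp _ (by omega)]; unfold HalfAdj; omega
      | (simp only [hadj, true_iff]; unfold HalfAdj; omega)
      | (simp only [hadj.symm, true_iff]; unfold HalfAdj; omega)
      | (simp only [SimpleGraph.irrefl, false_iff]; unfold HalfAdj; omega)

theorem halfAdj_of_even {i j : ℕ} (h : i % 2 = 0) : HalfAdj i j ↔ i < j ∧ j % 2 = 1 := by
  unfold HalfAdj; omega

theorem halfAdj_of_odd {i j : ℕ} (h : i % 2 = 1) : HalfAdj i j ↔ j < i ∧ j % 2 = 0 := by
  unfold HalfAdj; omega

/-- `p` and `q` are consecutive in the complementary order of the path on four vertices. -/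
def ComplConsec (p q : ℕ) : Prop :=
  (p = 2 ∧ q = 0) ∨ (p = 0 ∧ q = 2) ∨ (p = 0 ∧ q = 3) ∨ (p = 3 ∧ q = 0) ∨ (p = 3 ∧ q = 1) ∨
    (p = 1 ∧ q = 3)

theorem flip_const {n p q : ℕ} {s : Prop} (hn : n % 2 = 0) (hn4 : 4 ≤ n)
    (hp : p < n) (hq : q < n) (hpq : p ≠ q)
    (h : ∀ i < n, i ≠ p → ((HalfAdj p i ↔ i ≠ q) ↔ s)) :
    (¬ s ∧ (p = q + 1 ∨ q = p + 1)) ∨ (s ∧ n = 4 ∧ ComplConsec p q) := by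
  by_cases hs : s
  · have h1 : ∀ i < n, i ≠ p → i ≠ q → HalfAdj p i := fun i hi hip hiq => by
      simpa [hs, hiq] using h i hi hip
    have h2 : ¬ HalfAdj p q := by simpa [hs] using h q hq hpq.symm
    right
    refine ⟨hs, ?_⟩
    unfold ComplConsec
    rcases Nat.mod_two_eq_zero_or_one p with hp2 | hp2
    · simp only [halfAdj_of_even hp2] at h1 h2
      have a0 := h1 0 (by omega)
      have a1 := h1 2 (by omega)
      have a2 := h1 4
      have a3 := h1 1 (by omega)
      clear h1 h
      omega
    · simp only [halfAdj_of_odd hp2] at h1 h2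
      have a0 := h1 1 (by omega)
      have a1 := h1 3 (by omega)
      have a2 := h1 5
      have a3 := h1 2 (by omega)
      clear h1 h
      omega
  · have h1 : ∀ i < n, i ≠ p → i ≠ q → ¬ HalfAdj p i := fun i hi hip hiq => by
      simpa [hs, hiq] using h i hi hip
    have h2 : HalfAdj p q := by simpa [hs] using h q hq hpq.symm
    left
    refine ⟨hs, ?_⟩
    rcases Nat.mod_two_eq_zero_or_one p with hp2 | hp2
    · simp only [halfAdj_of_even hp2] at h1 h2
      have := h1 (p + 1)
      omega
    · simp only [halfAdj_of_odd hp2] at h1 h2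
      have := h1 (p - 1)
      omega

theorem flip_even_odd {n e o q : ℕ} (hn : n % 2 = 0) (hn4 : 4 ≤ n)
    (he : e < n) (hq : q < n) (ho : o < n) (he2 : e % 2 = 0) (ho2 : o % 2 = 1)
    (h : ∀ i < n, i ≠ e → i ≠ o → i ≠ q → ¬ (e < i ∧ i % 2 = 1) ∧ ¬ (i < o ∧ i % 2 = 0))
    (hq' : q ≠ e → q ≠ o → (e < q ∧ q % 2 = 1 ↔ ¬ (q < o ∧ q % 2 = 0))) :
    n = 4 ∧ ((e = 0 ∧ o = 1 ∧ q = 3) ∨ (e = 2 ∧ o = 3 ∧ q = 0)) := by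
  rcases Nat.mod_two_eq_zero_or_one q with hq2 | hq2
  · have a0 := h (n - 1) (by omega)
    have ho' : o = n - 1 := by omega
    have a1 := h (n - 3) (by omega)
    have he' : e = n - 2 := by omega
    have a2 := h 0 (by omega)
    have a3 := h 2 (by omega)
    clear h a0 a1
    subst ho' he'
    omega
  · have a0 := h 0 (by omega)
    have a1 := h 2 (by omega)
    have ho' : o = 1 := by omega
    have he' : e = 0 := by omega
    have a2 := h 3 (by omega)
    have a3 := h 5
    clear h a0 a1
    subst ho' he'
    omega

theorem flip_twin {n p q w : ℕ} {c : Prop} (hn : n % 2 = 0) (hn4 : 4 ≤ n)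
    (hp : p < n) (hq : q < n) (hpq : p ≠ q) (hw : w < n)
    (h : ∀ i < n, i ≠ p → i ≠ w → ((HalfAdj p i ↔ i ≠ q) ↔ HalfAdj w i))
    (hc : w ≠ p → (c ↔ HalfAdj w p)) :
    (¬ c ∧ (p = q + 1 ∨ q = p + 1)) ∨ (c ∧ n = 4 ∧ ComplConsec p q) := by
  have h1 : ∀ i < n, i ≠ p → i ≠ w → i ≠ q → (HalfAdj p i ↔ HalfAdj w i) :=
    fun i hi hip hiw hiq => by simpa [hiq] using h i hi hip hiw
  have h2 : q ≠ w → (HalfAdj p q ↔ ¬ HalfAdj w q) := fun hqw => by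
    have := h q hq hpq.symm hqw
    simp only [ne_eq, not_true_eq_false, iff_false] at this
    by_cases h3 : HalfAdj p q <;> simp [h3, ← this]
  have hwp : w ≠ p := by
    rintro rfl
    have := h2 hpq.symm
    tauto
  replace hc := hc hwp
  clear h
  rcases Nat.mod_two_eq_zero_or_one p with hp2 | hp2 <;>
    rcases Nat.mod_two_eq_zero_or_one w with hw2 | hw2
  · left
    rw [halfAdj_of_even hw2] at hc
    simp only [halfAdj_of_even hp2, halfAdj_of_even hw2] at h1 h2
    refine ⟨by rw [hc]; omega, ?_⟩
    have a0 := h1 (p + 1)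
    have a1 := h1 (p - 1)
    clear h1 hc
    omega
  · right
    rw [halfAdj_of_odd hw2] at hc
    simp only [halfAdj_of_even hp2, halfAdj_of_odd hw2] at h1 h2
    have h3 : ∀ i < n, i ≠ p → i ≠ w → i ≠ q → ¬ (p < i ∧ i % 2 = 1) ∧ ¬ (i < w ∧ i % 2 = 0) := by
      intro i hi hip hiw hiq
      have := h1 i hi hip hiw hiq
      omega
    obtain ⟨h4, h5⟩ := flip_even_odd hn hn4 hp hq hw hp2 hw2 h3 (fun _ => h2)
    refine ⟨?_, h4, ?_⟩
    · rw [hc]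
      omega
    · unfold ComplConsec
      omega
  · right
    rw [halfAdj_of_even hw2] at hc
    simp only [halfAdj_of_odd hp2, halfAdj_of_even hw2] at h1 h2
    have h3 : ∀ i < n, i ≠ w → i ≠ p → i ≠ q → ¬ (w < i ∧ i % 2 = 1) ∧ ¬ (i < p ∧ i % 2 = 0) := by
      intro i hi hiw hip hiq
      have := h1 i hi hip hiw hiq
      omega
    obtain ⟨h4, h5⟩ := flip_even_odd hn hn4 hw hq hp hw2 hp2 h3
      (fun hqw _ => by have := h2 hqw; omega)
    refine ⟨?_, h4, ?_⟩
    · rw [hc]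
      omega
    · unfold ComplConsec
      omega
  · left
    rw [halfAdj_of_odd hw2] at hc
    simp only [halfAdj_of_odd hp2, halfAdj_of_odd hw2] at h1 h2
    refine ⟨by rw [hc]; omega, ?_⟩
    have a0 := h1 (p + 1)
    have a1 := h1 (p - 1)
    clear h1 hc
    omega

theorem const_twin {n q w : ℕ} {s : Prop} (hn : n % 2 = 0) (hn4 : 4 ≤ n)
    (hq : q < n) (hw : w < n)
    (h : ∀ i < n, i ≠ w → ((s ↔ i ≠ q) ↔ HalfAdj w i)) :
    (¬ s ∧ (q = 0 ∨ q = n - 1)) ∨ (s ∧ n = 4 ∧ (q = 1 ∨ q = 2)) := by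
  by_cases hs : s
  · right
    refine ⟨hs, ?_⟩
    have h1 : ∀ i < n, i ≠ w → (i ≠ q ↔ HalfAdj w i) := fun i hi hiw => by
      simpa [hs] using h i hi hiw
    rcases Nat.mod_two_eq_zero_or_one w with hw2 | hw2
    · simp only [halfAdj_of_even hw2] at h1
      have a0 := h1 0 (by omega)
      have a1 := h1 1 (by omega)
      have a2 := h1 2 (by omega)
      have a3 := h1 4
      clear h1 h
      omega
    · simp only [halfAdj_of_odd hw2] at h1
      have a0 := h1 1 (by omega)
      have a1 := h1 2 (by omega)
      have a2 := h1 3 (by omega)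
      have a3 := h1 5
      clear h1 h
      omega
  · left
    refine ⟨hs, ?_⟩
    have h1 : ∀ i < n, i ≠ w → (i = q ↔ HalfAdj w i) := fun i hi hiw => by
      simpa [hs] using h i hi hiw
    rcases Nat.mod_two_eq_zero_or_one w with hw2 | hw2
    · simp only [halfAdj_of_even hw2] at h1
      have a0 := h1 (w + 1)
      have a1 := h1 (n - 1) (by omega)
      have a2 := h1 (n - 3) (by omega)
      have a3 := h1 q hq
      clear h1 h
      omega
    · simp only [halfAdj_of_odd hw2] at h1
      have a0 := h1 (w - 1) (by omega)
      have a1 := h1 0 (by omega)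
      have a2 := h1 2 (by omega)
      have a3 := h1 q hq
      clear h1 h
      omega

theorem const_const {n q : ℕ} {s t : Prop} (hn4 : 4 ≤ n)
    (hq : q < n) (h : ∀ i < n, ((s ↔ i ≠ q) ↔ t)) : False := by
  obtain ⟨i, hi, hiq⟩ : ∃ i < n, i ≠ q := by
    by_cases hq0 : q = 0
    · exact ⟨1, by omega, by omega⟩
    · exact ⟨0, by omega, by omega⟩
  have a := h q hq
  have b := h i hi
  simp only [hiq, ne_eq, not_true_eq_false, not_false_eq_true] at a b
  tauto

/-- No half graph on at least four vertices in `G` extends to a prime induced subgraph with one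
more vertex: each further vertex is either constant on it or a twin of one of its vertices. -/
def HalfSeqsUnextendable (G : SimpleGraph V) : Prop :=
  ∀ n v, IsHalfSeq G n v → n % 2 = 0 → 4 ≤ n → ∀ x, (∀ i < n, v i ≠ x) →
    (∃ s : Prop, ∀ i < n, (G.Adj x (v i) ↔ s)) ∨
    ∃ w < n, ∀ i < n, i ≠ w → (G.Adj x (v i) ↔ HalfAdj w i)

section Extension

variable {G : SimpleGraph V} {n p q : ℕ} {v : ℕ → V} {x y : V}

theorem IsHalfSeq.twin_flip (h : IsHalfSeq G n v) (H : HalfSeqsUnextendable G)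
    (hn : n % 2 = 0) (hn4 : 4 ≤ n) (hp : p < n) (hq : q < n) (hpq : p ≠ q)
    (hx : ∀ i < n, v i ≠ x) (hy : ∀ i < n, v i ≠ y) (hxy : x ≠ y)
    (hxp : ∀ i < n, i ≠ p → (G.Adj x (v i) ↔ HalfAdj p i))
    (hyq : ∀ i < n, i ≠ q → (G.Adj y (v i) ↔ HalfAdj q i))
    (hadj : G.Adj x y ↔ ¬ HalfAdj p q) :
    (¬ G.Adj x (v p) ∧ (p = q + 1 ∨ q = p + 1)) ∨
      (G.Adj x (v p) ∧ n = 4 ∧ ComplConsec p q) := by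
  have e1 : ∀ i < n, i ≠ p →
      (G.Adj x (Function.update v q y i) ↔ (HalfAdj p i ↔ i ≠ q)) := by
    intro i hi hip
    by_cases hiq : i = q
    · subst hiq
      simp [hadj]
    · simp [hiq, hxp i hi hip]
  have e2 : Function.update v q y p = v p := by simp [hpq]
  rcases H n _ (h.update hy hyq) hn hn4 x (fun i hi => by
    by_cases hiq : i = q
    · subst hiq
      simpa using hxy.symm
    · simpa [hiq] using hx i hi) with ⟨s, hs⟩ | ⟨w, hw, hs⟩
  · have e3 := hs p hp
    rw [e2] at e3
    rw [e3]
    exact flip_const hn hn4 hp hq hpq (fun i hi hip => by rw [← e1 i hi hip, hs i hi])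
  · refine flip_twin hn hn4 hp hq hpq hw
      (fun i hi hip hiw => by rw [← e1 i hi hip, hs i hi hiw]) (fun hwp => ?_)
    rw [← hs p hp hwp.symm, e2]

theorem IsHalfSeq.const_flip (h : IsHalfSeq G n v) (H : HalfSeqsUnextendable G)
    (hn : n % 2 = 0) (hn4 : 4 ≤ n) (hq : q < n)
    (hx : ∀ i < n, v i ≠ x) (hy : ∀ i < n, v i ≠ y) (hxy : x ≠ y) {s : Prop}
    (hxs : ∀ i < n, (G.Adj x (v i) ↔ s))
    (hyq : ∀ i < n, i ≠ q → (G.Adj y (v i) ↔ HalfAdj q i))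
    (hadj : G.Adj x y ↔ ¬ s) :
    (¬ s ∧ (q = 0 ∨ q = n - 1)) ∨ (s ∧ n = 4 ∧ (q = 1 ∨ q = 2)) := by
  have e1 : ∀ i < n, (G.Adj x (Function.update v q y i) ↔ (s ↔ i ≠ q)) := by
    intro i hi
    by_cases hiq : i = q
    · subst hiq
      simp [hadj]
    · simp [hiq, hxs i hi]
  rcases H n _ (h.update hy hyq) hn hn4 x (fun i hi => by
    by_cases hiq : i = q
    · subst hiq
      simpa using hxy.symm
    · simpa [hiq] using hx i hi) with ⟨t, ht⟩ | ⟨w, hw, ht⟩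
  · exact (const_const hn4 hq (fun i hi => by rw [← e1 i hi, ht i hi])).elim
  · exact const_twin hn hn4 hq hw (fun i hi hiw => by rw [← e1 i hi, ht i hi hiw])

theorem IsHalfSeq.exists_of_consec (h : IsHalfSeq G n v) (hp : p < n) (hq : q < n)
    (hpq : p = q + 1 ∨ q = p + 1)
    (hx : ∀ i < n, v i ≠ x) (hy : ∀ i < n, v i ≠ y) (hxy : x ≠ y)
    (hxp : ∀ i < n, (G.Adj x (v i) ↔ HalfAdj p i))
    (hyq : ∀ i < n, (G.Adj y (v i) ↔ HalfAdj q i))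
    (hadj : G.Adj x y ↔ ¬ HalfAdj p q) : ∃ v', IsHalfSeq G (n + 2) v' := by
  rcases hpq with rfl | rfl
  · exact h.insert_twins hy hx hxy.symm hp hyq hxp (by rw [G.adj_comm, hadj, halfAdj_comm])
  · exact h.insert_twins hx hy hxy hq hxp hyq hadj

theorem IsHalfSeq.exists_of_twin_twin (h : IsHalfSeq G n v) (H : HalfSeqsUnextendable G)
    (hn : n % 2 = 0) (hn4 : 4 ≤ n) (hp : p < n) (hq : q < n) (hpq : p ≠ q)
    (hx : ∀ i < n, v i ≠ x) (hy : ∀ i < n, v i ≠ y) (hxy : x ≠ y)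
    (hxp : ∀ i < n, i ≠ p → (G.Adj x (v i) ↔ HalfAdj p i))
    (hyq : ∀ i < n, i ≠ q → (G.Adj y (v i) ↔ HalfAdj q i))
    (hadj : G.Adj x y ↔ ¬ HalfAdj p q) :
    (∃ v', IsHalfSeq G (n + 2) v') ∨ ∃ v', IsHalfSeq Gᶜ (n + 2) v' := by
  have A := h.twin_flip H hn hn4 hp hq hpq hx hy hxy hxp hyq hadj
  have B := h.twin_flip H hn hn4 hq hp hpq.symm hy hx hxy.symm hyq hxp
    (by rw [G.adj_comm, hadj, halfAdj_comm])
  have C : (¬ G.Adj x (v p) ∧ ¬ G.Adj y (v q) ∧ (p = q + 1 ∨ q = p + 1)) ∨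
      (G.Adj x (v p) ∧ G.Adj y (v q) ∧ n = 4 ∧ ComplConsec p q) := by
    rcases A with A | A <;> rcases B with B | B
    · exact Or.inl ⟨A.1, B.1, A.2⟩
    · obtain ⟨-, A⟩ := A
      obtain ⟨-, -, B⟩ := B
      unfold ComplConsec at B
      omega
    · obtain ⟨-, B⟩ := B
      obtain ⟨-, -, A⟩ := A
      unfold ComplConsec at A
      omega
    · exact Or.inr ⟨A.1, B.1, A.2⟩
  rcases C with ⟨h1, h2, h3⟩ | ⟨h1, h2, rfl, h3⟩
  · refine Or.inl (h.exists_of_consec hp hq h3 hx hy hxy (fun i hi => ?_) (fun i hi => ?_) hadj)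
    · by_cases hip : i = p
      · subst hip
        simp [h1, HalfAdj]
      · exact hxp i hi hip
    · by_cases hiq : i = q
      · subst hiq
        simp [h2, HalfAdj]
      · exact hyq i hi hiq
  · right
    have lt : ∀ i, complOrder i < 4 := fun i => by unfold complOrder; split_ifs <;> omega
    have inv : ∀ i < 4, ∃ j < 4, complOrder j = i := by
      intro i hi
      interval_cases i
      exacts [⟨1, by simp [complOrder]⟩, ⟨3, by simp [complOrder]⟩, ⟨0, by simp [complOrder]⟩,
        ⟨2, by simp [complOrder]⟩]
    obtain ⟨p', hp', rfl⟩ := inv p hp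
    obtain ⟨q', hq', rfl⟩ := inv q hq
    have key : ∀ {r : ℕ} {z : V}, r < 4 → (∀ i < 4, v i ≠ z) → G.Adj z (v (complOrder r)) →
        (∀ i < 4, i ≠ complOrder r → (G.Adj z (v i) ↔ HalfAdj (complOrder r) i)) →
        ∀ i < 4, (Gᶜ.Adj z (v (complOrder i)) ↔ HalfAdj r i) := by
      intro r z hr hz hzr hzt i hi
      by_cases hir : i = r
      · subst hir
        simp [SimpleGraph.compl_adj, hzr, HalfAdj]
      · rw [SimpleGraph.compl_adj, hzt _ (lt i) (by
          unfold complOrder; interval_cases i <;> interval_cases r <;> simp at hir ⊢)]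
        simp only [ne_eq, (hz _ (lt i)).symm, not_false_eq_true, true_and]
        unfold HalfAdj complOrder
        interval_cases i <;> interval_cases r <;> simp at hir ⊢
    refine h.compl.exists_of_consec (p := p') (q := q') hp' hq' ?_
      (fun i _ => hx _ (lt i)) (fun i _ => hy _ (lt i)) hxy
      (key hp' hx h1 hxp) (key hq' hy h2 hyq) ?_
    · clear key hxp hyq h1 h2 A B hadj
      unfold ComplConsec complOrder at h3
      clear hp hq hpq
      interval_cases p' <;> interval_cases q' <;> simp at h3 ⊢
    · rw [SimpleGraph.compl_adj, hadj]
      simp only [ne_eq, hxy, not_false_eq_true, true_and, not_not]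
      clear key hxp hyq h1 h2 A B hadj
      unfold HalfAdj
      unfold ComplConsec at h3
      unfold complOrder at *
      interval_cases p' <;> interval_cases q' <;> simp at h3 ⊢

theorem IsHalfSeq.exists_of_isolated_last (h : IsHalfSeq G n v) (H : HalfSeqsUnextendable G)
    (hn : n % 2 = 0) (hn4 : 4 ≤ n)
    (hx : ∀ i < n, v i ≠ x) (hy : ∀ i < n, v i ≠ y) (hxy : x ≠ y)
    (hxs : ∀ i < n, ¬ G.Adj x (v i))
    (hyq : ∀ i < n, i ≠ n - 1 → (G.Adj y (v i) ↔ HalfAdj (n - 1) i))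
    (hadj : G.Adj x y) : ∃ v', IsHalfSeq G (n + 2) v' := by
  have hlast : ¬ G.Adj y (v (n - 1)) := by
    intro hcon
    have h1 : IsHalfSeq G n (Function.update v (n - 1) y) := h.update hy hyq
    have h1x : ∀ i < n, Function.update v (n - 1) y i ≠ x := fun i hi => by
      by_cases hi' : i = n - 1
      · simpa [hi'] using hxy.symm
      · simpa [hi'] using hx i hi
    have e1 : ∀ i < n, (G.Adj x (Function.update v (n - 1) y i) ↔ i = n - 1) := fun i hi => by
      by_cases hi' : i = n - 1
      · simpa [hi'] using hadj
      · simpa [hi'] using hxs i hi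
    have h1z : ∀ i < n, Function.update v (n - 1) y i ≠ v (n - 1) := fun i hi => by
      by_cases hi' : i = n - 1
      · simpa [hi'] using (hy (n - 1) (by omega)).symm
      · simp only [ne_eq, hi', not_false_eq_true, Function.update_of_ne]
        exact fun e => hi' (h.inj i hi (n - 1) (by omega) e)
    have := h1.twin_flip H hn hn4 (p := n - 1) (q := n - 2) (x := v (n - 1)) (y := x)
      (by omega) (by omega) (by omega) h1z h1x (hx _ (by omega))
      (fun i hi hi' => by simpa [hi'] using h.adj (n - 1) (by omega) i hi)
      (fun i hi hi' => by rw [e1 i hi]; unfold HalfAdj; omega)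
      (by
        rw [G.adj_comm]
        simp only [hxs (n - 1) (by omega), false_iff]
        unfold HalfAdj; omega)
    simp only [Function.update_self] at this
    rcases this with h2 | h2
    · exact h2.1 hcon.symm
    · obtain ⟨-, h2, h3⟩ := h2
      unfold ComplConsec at h3
      omega
  refine h.append hn (by omega) hx hy hxs (fun i hi => ?_) hadj
  by_cases hi' : i = n - 1
  · subst hi'
    simp [hlast, HalfAdj]
  · exact hyq i hi hi'

theorem IsHalfSeq.exists_of_isolated (h : IsHalfSeq G n v) (H : HalfSeqsUnextendable G)
    (hn : n % 2 = 0) (hn4 : 4 ≤ n) (hq : q = 0 ∨ q = n - 1)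
    (hx : ∀ i < n, v i ≠ x) (hy : ∀ i < n, v i ≠ y) (hxy : x ≠ y)
    (hxs : ∀ i < n, ¬ G.Adj x (v i))
    (hyq : ∀ i < n, i ≠ q → (G.Adj y (v i) ↔ HalfAdj q i))
    (hadj : G.Adj x y) : ∃ v', IsHalfSeq G (n + 2) v' := by
  rcases hq with rfl | rfl
  · refine (h.reverse hn).exists_of_isolated_last H hn hn4 (fun i hi => hx _ (by omega))
      (fun i hi => hy _ (by omega)) hxy (fun i hi => hxs _ (by omega)) (fun i hi hi' => ?_) hadj
    rw [hyq _ (by omega) (by omega)]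
    unfold HalfAdj; omega
  · exact h.exists_of_isolated_last H hn hn4 hx hy hxy hxs hyq hadj

theorem IsHalfSeq.exists_of_const_twin (h : IsHalfSeq G n v) (H : HalfSeqsUnextendable G)
    (Hc : HalfSeqsUnextendable Gᶜ)
    (hn : n % 2 = 0) (hn4 : 4 ≤ n) (hq : q < n)
    (hx : ∀ i < n, v i ≠ x) (hy : ∀ i < n, v i ≠ y) (hxy : x ≠ y) {s : Prop}
    (hxs : ∀ i < n, (G.Adj x (v i) ↔ s))
    (hyq : ∀ i < n, i ≠ q → (G.Adj y (v i) ↔ HalfAdj q i))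
    (hadj : G.Adj x y ↔ ¬ s) :
    (∃ v', IsHalfSeq G (n + 2) v') ∨ ∃ v', IsHalfSeq Gᶜ (n + 2) v' := by
  rcases h.const_flip H hn hn4 hq hx hy hxy hxs hyq hadj with ⟨h1, h2⟩ | ⟨h1, rfl, h2⟩
  · exact Or.inl (h.exists_of_isolated H hn hn4 h2 hx hy hxy
      (fun i hi => by rw [hxs i hi]; exact h1) hyq (hadj.2 h1))
  · right
    have lt : ∀ i, complOrder i < 4 := fun i => by unfold complOrder; split_ifs <;> omega
    refine h.compl.exists_of_isolated (q := if q = 1 then 3 else 0) Hc hn hn4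
      (by split_ifs <;> simp)
      (fun i _ => hx _ (lt i)) (fun i _ => hy _ (lt i)) hxy
      (fun i _ => by simp [SimpleGraph.compl_adj, hxs _ (lt i), h1]) (fun i hi hiq => ?_)
      (by simp [SimpleGraph.compl_adj, hxy, hadj, h1])
    have hne : complOrder i ≠ q := by
      unfold complOrder
      rcases h2 with rfl | rfl <;> interval_cases i <;> simp at hiq ⊢
    rw [SimpleGraph.compl_adj, hyq _ (lt i) hne]
    simp only [ne_eq, (hy _ (lt i)).symm, not_false_eq_true, true_and]
    unfold HalfAdj complOrder
    rcases h2 with rfl | rfl <;> interval_cases i <;> simp at hiq ⊢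

end Extension

/-- `X` is partitioned into two nonempty sets with no edge of `G` between them. -/
def IsSplit (G : SimpleGraph V) (X : Set V) : Prop :=
  ∃ A B : Set V, A.Nonempty ∧ B.Nonempty ∧ Disjoint A B ∧ A ∪ B = X ∧
    ∀ a ∈ A, ∀ b ∈ B, ¬ G.Adj a b

theorem exists_isHalfSeq_four {G : SimpleGraph V} {a b c d : V} (hab : G.Adj a b)
    (had : G.Adj a d) (hcd : G.Adj c d) (hac : ¬ G.Adj a c) (hbc : ¬ G.Adj b c)
    (hbd : ¬ G.Adj b d) : ∃ v, IsHalfSeq G 4 v := by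
  have h1 : a ≠ b := hab.ne
  have h2 : a ≠ d := had.ne
  have h3 : c ≠ d := hcd.ne
  have h4 : a ≠ c := fun h => hbc (h ▸ hab.symm)
  have h5 : b ≠ c := fun h => hbd (h ▸ hcd)
  have h6 : b ≠ d := fun h => hbc (h ▸ hcd.symm)
  refine ⟨fun i => if i = 0 then a else if i = 1 then b else if i = 2 then c else d,
    fun i hi j hj e => ?_, fun i hi j hj => ?_⟩
  · interval_cases i <;> interval_cases j <;> simp_all
  · unfold HalfAdj
    interval_cases i <;> interval_cases j <;>
      simp [hab, had, hcd, hac, hbc, hbd, hab.symm, had.symm, hcd.symm,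
        mt SimpleGraph.Adj.symm hac, mt SimpleGraph.Adj.symm hbc, mt SimpleGraph.Adj.symm hbd]

theorem isSplit_insert {G : SimpleGraph V} {A B : Set V} {v : V}
    (hB : ∃ b ∈ B, G.Adj v b) (hA : ∃ a ∈ A, ¬ G.Adj v a) (hdisj : Disjoint A B)
    (hAB : ∀ a ∈ A, ∀ b ∈ B, ¬ G.Adj a b) (hv : v ∉ A) (hno : ¬ ∃ v, IsHalfSeq G 4 v) :
    IsSplit G (insert v (A ∪ B)) := by
  obtain ⟨b, hb, hvb⟩ := hB
  obtain ⟨a, ha, hva⟩ := hA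
  refine ⟨{a | a ∈ A ∧ ¬ G.Adj v a}, insert v (B ∪ {a | a ∈ A ∧ G.Adj v a}), ⟨a, ha, hva⟩,
    ⟨v, Or.inl rfl⟩, ?_, ?_, ?_⟩
  · rw [Set.disjoint_left] at hdisj ⊢
    rintro c ⟨hc, hvc⟩ (rfl | h | h)
    · exact hv hc
    · exact hdisj hc h
    · exact hvc h.2
  · ext c
    simp only [Set.mem_union, Set.mem_insert_iff, Set.mem_ofPred_eq]
    tauto
  · rintro c ⟨hc, hvc⟩ d (rfl | h | ⟨hd, hvd⟩) hcd
    · exact hvc hcd.symm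
    · exact hAB c hc d h hcd
    · exact hno (exists_isHalfSeq_four hvb hvd hcd hvc (fun h => hAB c hc b hb h.symm)
        (fun h => hAB d hd b hb h.symm))

theorem IsSplit.insert_of_notMem {G : SimpleGraph V} {X : Set V} {v : V}
    (h : IsSplit G X) (hv : v ∉ X) (hno : ¬ ∃ v, IsHalfSeq G 4 v) :
    IsSplit G (insert v X) ∨ IsSplit Gᶜ (insert v X) := by
  obtain ⟨A, B, ⟨a, ha⟩, ⟨b, hb⟩, hdisj, rfl, hAB⟩ := h
  have hvA : v ∉ A := fun h => hv (Or.inl h)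
  have hvB : v ∉ B := fun h => hv (Or.inr h)
  by_cases h1 : ∃ b ∈ B, G.Adj v b
  · by_cases h2 : ∃ a ∈ A, G.Adj v a
    · by_cases h3 : ∃ a ∈ A, ¬ G.Adj v a
      · exact Or.inl (isSplit_insert h1 h3 hdisj hAB hvA hno)
      by_cases h4 : ∃ b ∈ B, ¬ G.Adj v b
      · rw [Set.union_comm]
        exact Or.inl (isSplit_insert h2 h4 hdisj.symm (fun b hb a ha h => hAB a ha b hb h.symm)
          hvB hno)
      push Not at h3 h4
      refine Or.inr ⟨{v}, A ∪ B, ⟨v, rfl⟩, ⟨a, Or.inl ha⟩, Set.disjoint_singleton_left.2 hv,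
        rfl, ?_⟩
      rintro _ rfl c (hc | hc) hvc
      · exact hvc.2 (h3 c hc)
      · exact hvc.2 (h4 c hc)
    · push Not at h2
      refine Or.inl ⟨A, insert v B, ⟨a, ha⟩, ⟨v, Or.inl rfl⟩, ?_, Set.union_insert, ?_⟩
      · exact Set.disjoint_insert_right.2 ⟨hvA, hdisj⟩
      · rintro c hc d (rfl | hd)
        · exact fun h => h2 c hc h.symm
        · exact hAB c hc d hd
  · push Not at h1
    refine Or.inl ⟨insert v A, B, ⟨v, Or.inl rfl⟩, ⟨b, hb⟩, ?_, Set.insert_union, ?_⟩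
    · exact Set.disjoint_insert_left.2 ⟨hvB, hdisj⟩
    · rintro c (rfl | hc) d hd
      · exact h1 d hd
      · exact hAB c hc d hd

theorem not_isSplit_univ {G : SimpleGraph V} (hG : IsPrimeOn G Set.univ)
    (h3 : 3 ≤ (Set.univ : Set V).ncard) : ¬ IsSplit G Set.univ := by
  rintro ⟨A, B, ⟨a, ha⟩, ⟨b, hb⟩, hdisj, hAB, hadj⟩
  rw [Set.disjoint_left] at hdisj
  have cover : ∀ z, z ∈ A ∨ z ∈ B := fun z => hAB.symm.subset (Set.mem_univ z)
  have hA : A.Subsingleton := by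
    rcases hG A (Set.subset_univ _) (fun z _ hz c hc d hd => by
      have hzB := (cover z).resolve_left hz
      exact iff_of_false (fun h => hadj c hc z hzB h.symm)
        (fun h => hadj d hd z hzB h.symm)) with h | h
    · exact h
    · exact absurd hb (hdisj (h.symm.subset (Set.mem_univ b)))
  have hB : B.Subsingleton := by
    rcases hG B (Set.subset_univ _) (fun z _ hz c hc d hd => by
      have hzA := (cover z).resolve_right hz
      exact iff_of_false (hadj z hzA c hc) (hadj z hzA d hd)) with h | h
    · exact h
    · exact absurd (h.symm.subset (Set.mem_univ a)) (hdisj ha)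
  obtain ⟨t, -, hta, htb⟩ := exists_mem_ne_ne h3 a b
  rcases cover t with h | h
  · exact hta (hA h ha)
  · exact htb (hB h hb)

/-- A finite prime graph contains an induced path on four vertices. -/
theorem IsPrimeOn.exists_isHalfSeq [Finite V] {G : SimpleGraph V} (hG : IsPrimeOn G Set.univ)
    (h3 : 3 ≤ (Set.univ : Set V).ncard) : ∃ v, IsHalfSeq G 4 v := by
  by_contra hno
  have hnoc : ¬ ∃ v, IsHalfSeq Gᶜ 4 v := by
    rintro ⟨v, hv⟩
    have := hv.compl
    rw [compl_compl] at this
    exact hno ⟨_, this⟩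
  have key : ∀ S : Set V, S.Finite → S.Subsingleton ∨ IsSplit G S ∨ IsSplit Gᶜ S := by
    intro S hS
    induction S, hS using Set.Finite.induction_on with
    | empty => exact Or.inl Set.subsingleton_empty
    | @insert v S hv _ ih =>
      rcases ih with h | h | h
      · rcases h.eq_empty_or_singleton with rfl | ⟨a, rfl⟩
        · left
          rw [insert_empty_eq]
          exact Set.subsingleton_singleton
        · right
          have hva : v ≠ a := hv
          by_cases hadj : G.Adj v a
          · exact Or.inr ⟨{v}, {a}, ⟨v, rfl⟩, ⟨a, rfl⟩, Set.disjoint_singleton.2 hva, rfl, by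
              rintro _ rfl _ rfl h
              exact h.2 hadj⟩
          · exact Or.inl ⟨{v}, {a}, ⟨v, rfl⟩, ⟨a, rfl⟩, Set.disjoint_singleton.2 hva, rfl, by
              rintro _ rfl _ rfl h
              exact hadj h⟩
      · exact Or.inr (h.insert_of_notMem hv hno)
      · right
        have := h.insert_of_notMem hv hnoc
        rw [compl_compl] at this
        exact this.symm
  rcases key Set.univ Set.finite_univ with h | h | h
  · have := Set.ncard_le_one_iff_subsingleton.2 h
    omega
  · exact not_isSplit_univ hG h3 h
  · exact not_isSplit_univ (isPrimeOn_compl.2 hG) h3 h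

/-- Every prime induced subgraph on at least four vertices misses an even number of vertices. -/
def HasEvenCodim (G : SimpleGraph V) : Prop :=
  ∀ X, IsPrimeOn G X → 4 ≤ X.ncard → Xᶜ.ncard % 2 = 0

theorem HasEvenCodim.compl {G : SimpleGraph V} (h : HasEvenCodim G) : HasEvenCodim Gᶜ :=
  fun X hX => h X (isPrimeOn_compl.1 hX)

theorem hasEvenCodim_of_critical [Finite V] {G : SimpleGraph V} (hG : IsPrimeOn G Set.univ)
    (hcrit : ∀ x, 4 ≤ ({x}ᶜ : Set V).ncard → ¬ IsPrimeOn G {x}ᶜ) : HasEvenCodim G := by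
  intro X
  induction hk : Xᶜ.ncard using Nat.strong_induction_on generalizing X with
  | _ k ih =>
    intro hX h4
    by_cases h0 : k = 0
    · rw [h0]
    by_cases h1 : k = 1
    · subst h1
      obtain ⟨x, hx⟩ := Set.ncard_eq_one.1 hk
      have hX' : X = {x}ᶜ := by rw [← hx, compl_compl]
      exact absurd (hX' ▸ hX) (hcrit x (hX' ▸ h4))
    obtain ⟨x₀, hx₀, y₀, hy₀, hxy₀⟩ := (Set.one_lt_ncard (Set.toFinite _)).1
      (show 1 < Xᶜ.ncard by omega)
    obtain ⟨x, y, hx, hy, hxy, hXxy⟩ := hG.exists_insert_insert hX (by omega) hx₀ hy₀ hxy₀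
    have hxX : x ∉ insert y X := by
      rintro (h | h)
      exacts [hxy h, hx h]
    have e1 := Set.ncard_insert_of_notMem hy (Set.toFinite X)
    have e2 := Set.ncard_insert_of_notMem hxX (Set.toFinite _)
    have e3 := Set.ncard_add_ncard_compl X
    have e4 := Set.ncard_add_ncard_compl (insert x (insert y X))
    have := ih _ (by omega) _ rfl hXxy (by omega)
    omega

theorem HasEvenCodim.halfSeqsUnextendable [Finite V] {G : SimpleGraph V} (h : HasEvenCodim G) :
    HalfSeqsUnextendable G := by
  intro n v hv hn hn4 x hx
  have hxX : x ∉ v '' Set.Iio n := by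
    rintro ⟨i, hi, e⟩
    exact hx i hi e
  have hX := hv.isPrimeOn hn
  have hc := hv.ncard
  rcases hX.insert_cases hxX (fun hcon => by
    have e1 := Set.ncard_insert_of_notMem hxX (Set.toFinite _)
    have e3 := Set.ncard_add_ncard_compl (v '' Set.Iio n)
    have e4 := Set.ncard_add_ncard_compl (insert x (v '' Set.Iio n))
    have := h _ hX (by omega)
    have := h _ hcon (by omega)
    omega) with h | ⟨_, ⟨w, hw, rfl⟩, h⟩
  · exact Or.inl ⟨G.Adj x (v 0), fun i hi =>
      h _ ⟨i, hi, rfl⟩ _ ⟨0, Set.mem_Iio.2 (by omega), rfl⟩⟩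
  · refine Or.inr ⟨w, hw, fun i hi hiw => ?_⟩
    rw [h _ ⟨i, hi, rfl⟩ (fun e => hiw (hv.inj i hi w hw e)), hv.adj w hw i hi]

theorem IsHalfSeq.exists_longer [Finite V] {G : SimpleGraph V} {n : ℕ} {v : ℕ → V}
    (hG : IsPrimeOn G Set.univ) (he : HasEvenCodim G)
    (hv : IsHalfSeq G n v) (hn : n % 2 = 0) (hn4 : 4 ≤ n) (hne : ∃ x, ∀ i < n, v i ≠ x) :
    (∃ v', IsHalfSeq G (n + 2) v') ∨ ∃ v', IsHalfSeq Gᶜ (n + 2) v' := by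
  have hX := hv.isPrimeOn hn
  have hc := hv.ncard
  have H := he.halfSeqsUnextendable
  have notMem : ∀ x, x ∉ v '' Set.Iio n ↔ ∀ i < n, v i ≠ x := by
    intro x
    constructor
    · exact fun h i hi e => h ⟨i, hi, e⟩
    · rintro h ⟨i, hi, e⟩
      exact h i hi e
  obtain ⟨x₀, hx₀⟩ := hne
  have hpos : 0 < (v '' Set.Iio n)ᶜ.ncard :=
    (Set.ncard_pos (Set.toFinite _)).2 ⟨x₀, (notMem x₀).2 hx₀⟩
  have heven := he _ hX (by omega)
  obtain ⟨x₀, hx₀, y₀, hy₀, hxy₀⟩ := (Set.one_lt_ncard (Set.toFinite _)).1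
    (show 1 < (v '' Set.Iio n)ᶜ.ncard by omega)
  obtain ⟨x, y, hxX, hyX, hxy, hXxy⟩ := hG.exists_insert_insert hX (by omega) hx₀ hy₀ hxy₀
  clear hx₀ hy₀ hxy₀ heven hpos
  have hx := (notMem x).1 hxX
  have hy := (notMem y).1 hyX
  have nomod : ∀ M : Set V, M ⊆ insert x (insert y (v '' Set.Iio n)) →
      (∃ a ∈ M, ∃ b ∈ M, a ≠ b) →
      (∃ c ∈ insert x (insert y (v '' Set.Iio n)), c ∉ M) →
      IsModuleOn G (insert x (insert y (v '' Set.Iio n))) M → False := by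
    rintro M hM ⟨a, ha, b, hb, hab⟩ ⟨c, hc, hcM⟩ hmod
    rcases hXxy M hM hmod with h | h
    · exact hab (h ha hb)
    · exact hcM (h ▸ hc)
  have mem : ∀ i < n, v i ∈ insert x (insert y (v '' Set.Iio n)) := fun i hi =>
    Or.inr (Or.inr ⟨i, hi, rfl⟩)
  have h01 : v 0 ≠ v 1 := fun e => by simpa using hv.inj 0 (by omega) 1 (by omega) e
  have const_const : ∀ s t : Prop, (∀ i < n, (G.Adj x (v i) ↔ s)) →
      (∀ i < n, (G.Adj y (v i) ↔ t)) → False := by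
    intro s t hs ht
    refine nomod (v '' Set.Iio n) (fun c hc => Or.inr (Or.inr hc))
      ⟨v 0, ⟨0, Set.mem_Iio.2 (by omega), rfl⟩, v 1, ⟨1, Set.mem_Iio.2 (by omega), rfl⟩, h01⟩
      ⟨x, Or.inl rfl, hxX⟩ ?_
    rintro z (rfl | rfl | hz) hzM _ ⟨i, hi, rfl⟩ _ ⟨j, hj, rfl⟩
    · rw [hs i hi, hs j hj]
    · rw [ht i hi, ht j hj]
    · exact absurd hz hzM
  have const_twin : ∀ {x y : V}, x ∉ v '' Set.Iio n → y ∉ v '' Set.Iio n → x ≠ y →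
      IsPrimeOn G (insert x (insert y (v '' Set.Iio n))) →
      ∀ (s : Prop) (q : ℕ), q < n → (∀ i < n, (G.Adj x (v i) ↔ s)) →
      (∀ i < n, i ≠ q → (G.Adj y (v i) ↔ HalfAdj q i)) →
      (∃ v', IsHalfSeq G (n + 2) v') ∨ ∃ v', IsHalfSeq Gᶜ (n + 2) v' := by
    intro x y hxX hyX hxy hXxy s q hq hxs hyq
    refine hv.exists_of_const_twin H he.compl.halfSeqsUnextendable hn hn4 hq
      ((notMem x).1 hxX) ((notMem y).1 hyX) hxy hxs hyq ?_
    by_contra hadj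
    have hadj : G.Adj x y ↔ s := by tauto
    rcases hXxy (insert y (v '' Set.Iio n)) (Set.subset_insert _ _) (by
      rintro z (rfl | hz) hzM
      · have key : ∀ a ∈ insert y (v '' Set.Iio n), (G.Adj z a ↔ s) := by
          rintro a (rfl | ⟨i, hi, rfl⟩)
          · exact hadj
          · exact hxs i hi
        intro a ha b hb
        rw [key a ha, key b hb]
      · exact absurd hz hzM) with h | h
    · exact h01 (h (Or.inr ⟨0, Set.mem_Iio.2 (by omega), rfl⟩)
        (Or.inr ⟨1, Set.mem_Iio.2 (by omega), rfl⟩))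
    · rcases h.symm.subset (Or.inl rfl) with h | h
      · exact hxy h
      · exact hxX h
  rcases H n v hv hn hn4 x hx with ⟨s, hs⟩ | ⟨p, hp, hxp⟩ <;>
    rcases H n v hv hn hn4 y hy with ⟨t, ht⟩ | ⟨q, hq, hyq⟩
  · exact (const_const s t hs ht).elim
  · exact const_twin hxX hyX hxy hXxy s q hq hs hyq
  · exact const_twin hyX hxX hxy.symm (Set.insert_comm x y _ ▸ hXxy) t p hp ht hxp
  · by_cases hpq : p = q
    · subst hpq
      refine (nomod {v p, x, y} ?_ ⟨x, by simp, y, by simp, hxy⟩ ?_ ?_).elim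
      · rintro c (rfl | rfl | rfl)
        exacts [mem p hp, Or.inl rfl, Or.inr (Or.inl rfl)]
      · obtain ⟨r, hr, hrp⟩ : ∃ r < n, r ≠ p := by
          by_cases h : p = 0
          · exact ⟨1, by omega, by omega⟩
          · exact ⟨0, by omega, by omega⟩
        refine ⟨v r, mem r hr, ?_⟩
        rintro (h | h | h)
        exacts [hrp (hv.inj r hr p hp h), hx r hr h, hy r hr h]
      · rintro z (rfl | rfl | ⟨i, hi, rfl⟩) hz
        · simp at hz
        · simp at hz
        · have hip : i ≠ p := fun e => hz (Or.inl (by rw [e]))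
          have key : ∀ a ∈ ({v p, x, y} : Set V), (G.Adj (v i) a ↔ HalfAdj p i) := by
            rintro a (rfl | rfl | rfl)
            · rw [hv.adj i hi p hp, halfAdj_comm]
            · rw [G.adj_comm, hxp i hi hip]
            · rw [G.adj_comm, hyq i hi hip]
          intro a ha b hb
          rw [key a ha, key b hb]
    · refine hv.exists_of_twin_twin H hn hn4 hp hq hpq hx hy hxy hxp hyq ?_
      by_contra hadj
      have hadj : G.Adj x y ↔ HalfAdj p q := by
        by_cases h : HalfAdj p q <;> simpa [h] using hadj
      refine nomod {v p, x} ?_ ⟨v p, by simp, x, by simp, hx p hp⟩ ⟨y, by simp, ?_⟩ ?_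
      · rintro c (rfl | rfl)
        exacts [mem p hp, Or.inl rfl]
      · rintro (h | h)
        exacts [hy p hp h.symm, hxy h.symm]
      · have main : ∀ z ∈ insert x (insert y (v '' Set.Iio n)), z ∉ ({v p, x} : Set V) →
            (G.Adj z x ↔ G.Adj z (v p)) := by
          rintro z (rfl | rfl | ⟨i, hi, rfl⟩) hz
          · simp at hz
          · rw [G.adj_comm, hadj, hyq p hp hpq, halfAdj_comm]
          · have hip : i ≠ p := fun e => hz (Or.inl (by rw [e]))
            rw [G.adj_comm, hxp i hi hip, hv.adj i hi p hp, halfAdj_comm]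
        intro z hz hzM a ha b hb
        have := main z hz hzM
        rcases ha with rfl | rfl <;> rcases hb with rfl | rfl <;>
          first | rfl | exact this | exact this.symm

theorem isModule_iff_isModuleOn_univ {G : SimpleGraph V} {M : Set V} :
    IsModule G M ↔ IsModuleOn G Set.univ M := by
  constructor
  · intro h z _ hz a ha b hb
    rcases h z hz with h | h
    · exact iff_of_true (h a ha) (h b hb)
    · exact iff_of_false (h a ha) (h b hb)
  · intro h z hz
    by_cases hc : ∃ a ∈ M, G.Adj z a
    · obtain ⟨a, ha, hza⟩ := hc
      exact Or.inl fun b hb => (h z (Set.mem_univ z) hz a ha b hb).1 hza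
    · push Not at hc
      exact Or.inr hc

theorem isPrimitive_iff {G : SimpleGraph V} :
    IsPrimitive G ↔ 4 ≤ Nat.card V ∧ IsPrimeOn G Set.univ := by
  refine and_congr_right fun _ => ⟨fun h M _ hM => ?_, fun h M hM => ?_⟩
  · rcases h M (isModule_iff_isModuleOn_univ.2 hM) with rfl | ⟨x, rfl⟩ | h
    · exact Or.inl Set.subsingleton_empty
    · exact Or.inl Set.subsingleton_singleton
    · exact Or.inr h
  · rcases h M (Set.subset_univ M) (isModule_iff_isModuleOn_univ.1 hM) with h | h
    · rcases h.eq_empty_or_singleton with h | h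
      · exact Or.inl h
      · exact Or.inr (Or.inl h)
    · exact Or.inr (Or.inr h)

theorem isPrimeOn_induce_univ {G : SimpleGraph V} {X : Set V} :
    IsPrimeOn (G.induce X) Set.univ ↔ IsPrimeOn G X := by
  constructor
  · intro h M hMX hM
    rcases h (Subtype.val ⁻¹' M) (Set.subset_univ _) (fun z _ hz a ha b hb =>
      hM z z.2 hz a ha b hb) with h | h
    · exact Or.inl fun a ha b hb =>
        congrArg Subtype.val (h (show (⟨a, hMX ha⟩ : X) ∈ Subtype.val ⁻¹' M from ha)
          (show (⟨b, hMX hb⟩ : X) ∈ Subtype.val ⁻¹' M from hb))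
    · exact Or.inr (Set.Subset.antisymm hMX fun a ha => h.symm.subset (Set.mem_univ ⟨a, ha⟩))
  · intro h M _ hM
    rcases h (Subtype.val '' M) (by rintro _ ⟨a, -, rfl⟩; exact a.2) (by
      rintro z hz hzM _ ⟨a, ha, rfl⟩ _ ⟨b, hb, rfl⟩
      exact hM ⟨z, hz⟩ (Set.mem_univ _) (fun h => hzM ⟨_, h, rfl⟩) a ha b hb) with h | h
    · exact Or.inl fun a ha b hb => Subtype.ext (h ⟨a, ha, rfl⟩ ⟨b, hb, rfl⟩)
    · refine Or.inr (Set.eq_univ_of_forall fun a => ?_)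
      obtain ⟨b, hb, e⟩ := h.symm.subset a.2
      rwa [← Subtype.ext e]

theorem isCriticalPrimitive_iff {G : SimpleGraph V} :
    IsCriticalPrimitive G ↔ 4 ≤ Nat.card V ∧ IsPrimeOn G Set.univ ∧
      ∀ x, 4 ≤ ({x}ᶜ : Set V).ncard → ¬ IsPrimeOn G {x}ᶜ := by
  simp only [IsCriticalPrimitive, isPrimitive_iff, isPrimeOn_induce_univ, Nat.card_coe_set_eq,
    not_and, and_assoc]

theorem isCriticalPrimitive_compl {G : SimpleGraph V} :
    IsCriticalPrimitive Gᶜ ↔ IsCriticalPrimitive G := by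
  simp only [isCriticalPrimitive_iff, isPrimeOn_compl]

theorem IsCriticalPrimitive.exists_isHalfSeq [Finite V] {G : SimpleGraph V}
    (h : IsCriticalPrimitive G) :
    ∃ n v, n % 2 = 0 ∧ 4 ≤ n ∧ (IsHalfSeq G n v ∨ IsHalfSeq Gᶜ n v) ∧ ∀ x, ∃ i < n, v i = x := by
  obtain ⟨h4, hG, hcrit⟩ := isCriticalPrimitive_iff.1 h
  by_contra! hcon
  have he := hasEvenCodim_of_critical hG hcrit
  have key : ∀ k, ∃ v, IsHalfSeq G (2 * k + 4) v ∨ IsHalfSeq Gᶜ (2 * k + 4) v := by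
    intro k
    induction k with
    | zero =>
      obtain ⟨v, hv⟩ := hG.exists_isHalfSeq (by rw [Set.ncard_univ]; omega)
      exact ⟨v, Or.inl hv⟩
    | succ k ih =>
      obtain ⟨v, hv⟩ := ih
      have hne := hcon (2 * k + 4) v (by omega) (by omega) hv
      rcases hv with hv | hv
      · rcases hv.exists_longer hG he (by omega) (by omega) hne with ⟨w, hw⟩ | ⟨w, hw⟩
        · exact ⟨w, Or.inl hw⟩
        · exact ⟨w, Or.inr hw⟩
      · rcases hv.exists_longer (isPrimeOn_compl.2 hG) he.compl (by omega) (by omega) hne with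
          ⟨w, hw⟩ | ⟨w, hw⟩
        · exact ⟨w, Or.inr hw⟩
        · rw [compl_compl] at hw
          exact ⟨w, Or.inl hw⟩
  obtain ⟨v, hv⟩ := key (Nat.card V)
  have hc : (v '' Set.Iio (2 * Nat.card V + 4)).ncard = 2 * Nat.card V + 4 := by
    rcases hv with hv | hv
    · exact hv.ncard
    · exact hv.ncard
  have := Set.ncard_le_ncard (Set.subset_univ (v '' Set.Iio (2 * Nat.card V + 4)))
  rw [Set.ncard_univ] at this
  omega

theorem IsHalfSeq.isCriticalPrimitive {G : SimpleGraph V} {n : ℕ} {v : ℕ → V}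
    (h : IsHalfSeq G n v) (hn : n % 2 = 0) (hn4 : 4 ≤ n) (hs : ∀ x, ∃ i < n, v i = x) :
    IsCriticalPrimitive G := by
  have huniv : v '' Set.Iio n = Set.univ := Set.eq_univ_of_forall fun x => by
    obtain ⟨i, hi, e⟩ := hs x
    exact ⟨i, hi, e⟩
  refine isCriticalPrimitive_iff.2 ⟨?_, huniv ▸ h.isPrimeOn hn, ?_⟩
  · rw [← Set.ncard_univ, ← huniv, h.ncard]
    exact hn4
  intro x _ hx
  obtain ⟨k, hk, rfl⟩ := hs x
  have twins : ∀ i < n, ∀ j < n, i ≠ j → i ≠ k → j ≠ k →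
      (∀ l < n, l ≠ k → l ≠ i → l ≠ j → (HalfAdj l i ↔ HalfAdj l j)) → False := by
    intro i hi j hj hij hik hjk hl
    rcases hx {v i, v j} (by
      rintro _ (rfl | rfl) e
      exacts [hik (h.inj i hi k hk e), hjk (h.inj j hj k hk e)]) (by
      intro z hz hzM a ha b hb
      obtain ⟨l, hln, rfl⟩ := hs z
      have e := hl l hln (fun e => hz (by rw [e]; rfl)) (fun e => hzM (Or.inl (by rw [e])))
        (fun e => hzM (Or.inr (by rw [e]; rfl)))
      rw [← h.adj l hln i hi, ← h.adj l hln j hj] at e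
      rcases ha with rfl | rfl <;> rcases hb with rfl | rfl <;>
        first | rfl | exact e | exact e.symm) with h' | h'
    · exact hij (h.inj i hi j hj (h' (Or.inl rfl) (Or.inr rfl)))
    · obtain ⟨l, hl, h1, h2, h3⟩ : ∃ l < n, l ≠ i ∧ l ≠ j ∧ l ≠ k := by
        by_contra! hcon
        have a0 := hcon 0 (by omega)
        have a1 := hcon 1 (by omega)
        have a2 := hcon 2 (by omega)
        have a3 := hcon 3 (by omega)
        omega
      rcases h'.symm.subset (show v l ∈ {v k}ᶜ from fun e => h3 (h.inj l hl k hk e)) with e | e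
      · exact h1 (h.inj l hl i hi e)
      · exact h2 (h.inj l hl j hj e)
  have isolated : ∀ i < n, i ≠ k → (∀ l < n, l ≠ k → ¬ HalfAdj i l) → False := by
    intro i hi hik hiso
    rcases hx {z | z ≠ v k ∧ z ≠ v i} (fun z hz => hz.1) (by
      intro z hz hzM a ha b hb
      have hzi : z = v i := by
        by_contra hzi
        exact hzM ⟨hz, hzi⟩
      subst hzi
      obtain ⟨l, hl, rfl⟩ := hs a
      obtain ⟨m, hm, rfl⟩ := hs b
      rw [h.adj i hi l hl, h.adj i hi m hm]
      exact iff_of_false (hiso l hl fun e => ha.1 (by rw [e])) (hiso m hm fun e => hb.1 (by rw [e])))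
      with h' | h'
    · obtain ⟨l, hl, h1, h2⟩ : ∃ l < n, l ≠ i ∧ l ≠ k := by
        by_contra! hcon
        have a0 := hcon 0 (by omega)
        have a1 := hcon 1 (by omega)
        have a2 := hcon 2 (by omega)
        omega
      obtain ⟨m, hm, h3, h4, h5⟩ : ∃ m < n, m ≠ i ∧ m ≠ k ∧ m ≠ l := by
        by_contra! hcon
        have a0 := hcon 0 (by omega)
        have a1 := hcon 1 (by omega)
        have a2 := hcon 2 (by omega)
        have a3 := hcon 3 (by omega)
        omega
      refine h5 (h.inj m hm l hl (h' ⟨fun e => ?_, fun e => ?_⟩ ⟨fun e => ?_, fun e => ?_⟩))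
      exacts [h4 (h.inj m hm k hk e), h3 (h.inj m hm i hi e), h2 (h.inj l hl k hk e),
        h1 (h.inj l hl i hi e)]
    · exact (h'.symm.subset (show v i ∈ {v k}ᶜ from fun e => hik (h.inj i hi k hk e))).2 rfl
  by_cases h0 : k = 0
  · exact isolated 1 (by omega) (by omega) (fun l hl hlk => by unfold HalfAdj; omega)
  by_cases h1 : k = n - 1
  · exact isolated (n - 2) (by omega) (by omega) (fun l hl hlk => by unfold HalfAdj; omega)
  · exact twins (k - 1) (by omega) (k + 1) (by omega) (by omega) (by omega) (by omega)
      (fun l hl h1 h2 h3 => by unfold HalfAdj; omega)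

theorem calG_adj_inl_inr {r : ℕ} {i j : Fin r} :
    (calG r).Adj (Sum.inl i) (Sum.inr j) ↔ j ≤ i := by
  simp [calG, SimpleGraph.fromRel_adj]

theorem calG_not_adj_inl_inl {r : ℕ} {i j : Fin r} :
    ¬ (calG r).Adj (Sum.inl i) (Sum.inl j) := by
  simp [calG, SimpleGraph.fromRel_adj]

theorem calG_not_adj_inr_inr {r : ℕ} {i j : Fin r} :
    ¬ (calG r).Adj (Sum.inr i) (Sum.inr j) := by
  simp [calG, SimpleGraph.fromRel_adj]

/-- The position of a vertex of `𝒢_r` in the list `b₁, a₁, b₂, a₂, …`. -/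
def calGIndex (r : ℕ) : Fin r ⊕ Fin r → ℕ
  | Sum.inl i => 2 * i + 1
  | Sum.inr j => 2 * j

theorem calGIndex_lt {r : ℕ} (x : Fin r ⊕ Fin r) : calGIndex r x < 2 * r := by
  rcases x with i | i <;> simp only [calGIndex] <;> omega

theorem calGIndex_injective (r : ℕ) : Function.Injective (calGIndex r) := by
  rintro (i | i) (j | j) h <;> simp only [calGIndex] at h
  · exact congrArg _ (Fin.ext (by omega))
  · omega
  · omega
  · exact congrArg _ (Fin.ext (by omega))

theorem calGIndex_surjective {r k : ℕ} (hk : k < 2 * r) : ∃ x, calGIndex r x = k := by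
  rcases Nat.mod_two_eq_zero_or_one k with h | h
  · exact ⟨Sum.inr ⟨k / 2, by omega⟩, by simp only [calGIndex]; omega⟩
  · exact ⟨Sum.inl ⟨k / 2, by omega⟩, by simp only [calGIndex]; omega⟩

theorem calG_adj_iff {r : ℕ} (x y : Fin r ⊕ Fin r) :
    (calG r).Adj x y ↔ HalfAdj (calGIndex r x) (calGIndex r y) := by
  rcases x with i | i <;> rcases y with j | j
  · simp only [calG_not_adj_inl_inl, false_iff, calGIndex, HalfAdj]; omega
  · simp only [calG_adj_inl_inr, calGIndex, HalfAdj, Fin.le_def]; omega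
  · rw [SimpleGraph.adj_comm]
    simp only [calG_adj_inl_inr, calGIndex, HalfAdj, Fin.le_def]; omega
  · simp only [calG_not_adj_inr_inr, false_iff, calGIndex, HalfAdj]; omega

theorem nonempty_iso_calG_iff {G : SimpleGraph V} {r : ℕ} (hr : 1 ≤ r) :
    Nonempty (G ≃g calG r) ↔ ∃ v, IsHalfSeq G (2 * r) v ∧ ∀ x, ∃ i < 2 * r, v i = x := by
  constructor
  · rintro ⟨e⟩
    have hex : ∀ k, ∃ x, k < 2 * r → calGIndex r x = k := fun k => by
      by_cases hk : k < 2 * r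
      · obtain ⟨x, hx⟩ := calGIndex_surjective hk
        exact ⟨x, fun _ => hx⟩
      · exact ⟨Sum.inl ⟨0, hr⟩, fun h => absurd h hk⟩
    choose f hf using hex
    refine ⟨fun k => e.symm (f k), ⟨fun i hi j hj h => ?_, fun i hi j hj => ?_⟩, fun x => ?_⟩
    · rw [← hf i hi, ← hf j hj, e.symm.injective h]
    · rw [e.symm.map_adj_iff, calG_adj_iff, hf i hi, hf j hj]
    · refine ⟨calGIndex r (e x), calGIndex_lt _, ?_⟩
      change e.symm (f _) = x
      rw [calGIndex_injective r (hf _ (calGIndex_lt (e x))), e.symm_apply_apply]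
  · rintro ⟨v, hv, hs⟩
    have hbij : Function.Bijective (fun x => v (calGIndex r x)) := by
      constructor
      · exact fun x y h => calGIndex_injective r
          (hv.inj _ (calGIndex_lt x) _ (calGIndex_lt y) h)
      · intro x
        obtain ⟨i, hi, rfl⟩ := hs x
        obtain ⟨y, rfl⟩ := calGIndex_surjective hi
        exact ⟨y, rfl⟩
    have e : calG r ≃g G := ⟨Equiv.ofBijective _ hbij, fun {x y} => by
      rw [calG_adj_iff]
      exact hv.adj _ (calGIndex_lt x) _ (calGIndex_lt y)⟩
    exact ⟨e.symm⟩

theorem nonempty_iso_compl_iff {W : Type} {G : SimpleGraph V} {H : SimpleGraph W} :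
    Nonempty (G ≃g Hᶜ) ↔ Nonempty (Gᶜ ≃g H) := by
  constructor
  · rintro ⟨e⟩
    refine ⟨e.toEquiv, fun {a b} => ?_⟩
    have h1 : Hᶜ.Adj (e a) (e b) ↔ G.Adj a b := e.map_adj_iff
    have h2 : e a = e b ↔ a = b := e.injective.eq_iff
    have h3 : H.Adj (e a) (e b) → e a ≠ e b := fun h => h.ne
    change H.Adj (e a) (e b) ↔ _
    simp only [SimpleGraph.compl_adj, ne_eq, ← h1, ← h2]
    tauto
  · rintro ⟨e⟩
    refine ⟨e.toEquiv, fun {a b} => ?_⟩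
    have h1 : H.Adj (e a) (e b) ↔ Gᶜ.Adj a b := e.map_adj_iff
    have h2 : e a = e b ↔ a = b := e.injective.eq_iff
    have h3 : G.Adj a b → a ≠ b := fun h => h.ne
    change Hᶜ.Adj (e a) (e b) ↔ _
    simp only [SimpleGraph.compl_adj, ne_eq, h1, h2]
    tauto

end HalfGraphs

/-- A finite simple graph is critical-primitive if and only if it is
isomorphic to `𝒢_r` or to the complement of `𝒢_r` for some `r ≥ 2`. -/
theorem criticalPrimitive_iff_calG {V : Type} [Fintype V] (G : SimpleGraph V) :
    IsCriticalPrimitive G ↔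
      ∃ r : ℕ, 2 ≤ r ∧
        (Nonempty (G ≃g calG r) ∨ Nonempty (G ≃g (calG r)ᶜ)) := by
  constructor
  · intro h
    obtain ⟨n, v, hn, hn4, hv, hs⟩ := h.exists_isHalfSeq
    obtain ⟨r, rfl⟩ : ∃ r, n = 2 * r := ⟨n / 2, by omega⟩
    refine ⟨r, by omega, ?_⟩
    rw [nonempty_iso_compl_iff]
    rcases hv with hv | hv
    · exact Or.inl ((nonempty_iso_calG_iff (by omega)).2 ⟨v, hv, hs⟩)
    · exact Or.inr ((nonempty_iso_calG_iff (by omega)).2 ⟨v, hv, hs⟩)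
  · rintro ⟨r, hr, h⟩
    rw [nonempty_iso_compl_iff, nonempty_iso_calG_iff (by omega),
      nonempty_iso_calG_iff (by omega)] at h
    rcases h with ⟨v, hv, hs⟩ | ⟨v, hv, hs⟩
    · exact hv.isCriticalPrimitive (by omega) (by omega) hs
    · exact isCriticalPrimitive_compl.1 (hv.isCriticalPrimitive (by omega) (by omega) hs)
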